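/- arXiv:2501.04186 — 6 statements merged into one kernel-verified Lean document; each statement's English description precedes it below -/
import Mathlib

section
/- Let B₁ and B₂ be signed chord diagrams on chord sets E₁ and E₂. Suppose there is a bijection φ : E₁ → E₂ such that for all distinct e, e′ ∈ E₁, e and e′ are interlaced in B₁ if and only if φ(e) and φ(e′) are interlaced in B₂, and such that s₁(e) = s₂(φ(e)) for every e ∈ E₁ (i.e. B₁ and B₂ have the same signed intersection graph). Then ∂ε^×_{B₁}(z) = ∂ε^×_{B₂}(z). -/
open Finset Polynomial

/-- A signed chord diagram (bouquet) on a finite chord set `E` with `n` chords: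
the `2*n` cyclic positions are labeled by chords via `chord`, each chord occupying
exactly two positions, and each chord carries a sign (`true` = `+1` = untwisted,
`false` = `-1` = twisted). -/
structure Bouquet (n : ℕ) (E : Type) [Fintype E] [DecidableEq E] where
  chord : Fin (2 * n) → E
  sign : E → Bool
  fiber_two : ∀ e : E, (Finset.univ.filter fun i => chord i = e).card = 2

namespace Bouquet

variable {n : ℕ} {E : Type} [Fintype E] [DecidableEq E]

/-- The partial Petrial `B^{×|A}`: same chord diagram, signs flipped exactly on `A`. -/
def petrial (B : Bouquet n E) (A : Finset E) : Bouquet n E where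
  chord := B.chord
  sign := fun e => if e ∈ A then !B.sign e else B.sign e
  fiber_two := B.fiber_two

/-- The boundary graph on the `4*n` points `(i, b)` (with `b = true` meaning `i⁺` and
`b = false` meaning `i⁻`): the matching `σ` joins `i⁺` to `(i+1)⁻`, and the matching `τ`
joins, for each chord with endpoints `{i, j}`, the points `i⁺,j⁻` and `i⁻,j⁺` when the
sign is `+1`, and the points `i⁺,j⁺` and `i⁻,j⁻` when the sign is `-1`. -/
def boundaryGraph (B : Bouquet n E) : SimpleGraph (Fin (2 * n) × Bool) :=
  SimpleGraph.fromRel fun x y =>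
    (x.2 = true ∧ y.2 = false ∧ y.1.val = (x.1.val + 1) % (2 * n)) ∨
    (B.chord x.1 = B.chord y.1 ∧ x.1 ≠ y.1 ∧
      (if B.sign (B.chord x.1) then x.2 ≠ y.2 else x.2 = y.2))

/-- `f(B)`: the number of boundary components of `B`, i.e. the number of connected
components of the boundary graph. -/
noncomputable def numBoundary (B : Bouquet n E) : ℕ :=
  Nat.card B.boundaryGraph.ConnectedComponent

/-- The Euler genus `ε(B) = n + 1 - f(B)`. -/
noncomputable def eulerGenus (B : Bouquet n E) : ℕ :=
  n + 1 - B.numBoundary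

/-- The partial Petrial polynomial `∂ε^×_B(z) = Σ_{A ⊆ E} z^{ε(B^{×|A})}`. -/
noncomputable def petrialPoly (B : Bouquet n E) : Polynomial ℤ :=
  ∑ A : Finset E, Polynomial.X ^ (B.petrial A).eulerGenus

/-- Two distinct chords are interlaced if exactly one endpoint of the second lies in
one of the two open arcs determined by the endpoints of the first (expressed here by
cutting the circle between positions `2*n - 1` and `0`). -/
def Interlaced (B : Bouquet n E) (e e' : E) : Prop :=
  e ≠ e' ∧ ∃ i j : Fin (2 * n), B.chord i = e ∧ B.chord j = e ∧ i < j ∧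
    (Finset.univ.filter fun k => B.chord k = e' ∧ i < k ∧ k < j).card = 1

/-- The intersection graph `I(B)`: vertices are the chords, two chords adjacent iff
interlaced. -/
def intersectionGraph (B : Bouquet n E) : SimpleGraph E :=
  SimpleGraph.fromRel B.Interlaced

end Bouquet

namespace SimpleGraph

/-- Functions on the connected components of a graph correspond to functions on its vertices
that are constant along edges. -/
def connectedComponentFunEquiv {V : Type*} (G : SimpleGraph V) (R : Type*) :
    (G.ConnectedComponent → R) ≃ {h : V → R // ∀ v w, G.Adj v w → h v = h w} where
  toFun c := ⟨fun v => c (G.connectedComponentMk v), fun _ _ hvw =>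
    congrArg c (ConnectedComponent.connectedComponentMk_eq_of_adj hvw)⟩
  invFun h := ConnectedComponent.lift h.1 fun _ _ p _ => by
    induction p with
    | nil => rfl
    | cons hadj _ ih => exact (h.2 _ _ hadj).trans (ih (by simp_all [Walk.cons_isPath_iff]))
  left_inv c := by
    funext v
    induction v using ConnectedComponent.ind
    rfl
  right_inv h := rfl

end SimpleGraph

namespace Bouquet

variable {n : ℕ} {E : Type} [Fintype E] [DecidableEq E]

lemma card_eq (B : Bouquet n E) : n = Fintype.card E := by
  have h := Finset.card_eq_sum_card_fiberwise (f := B.chord) (s := Finset.univ)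
    (t := Finset.univ) (fun _ _ => Finset.mem_univ _)
  simp only [B.fiber_two, Finset.card_univ, Fintype.card_fin, Finset.sum_const,
    smul_eq_mul] at h
  lia

lemma exists_chord_eq (B : Bouquet n E) (e : E) : ∃ i, B.chord i = e := by
  have h : 0 < (Finset.univ.filter fun i => B.chord i = e).card := by simp [B.fiber_two]
  obtain ⟨i, hi⟩ := Finset.card_pos.1 h
  exact ⟨i, (Finset.mem_filter.1 hi).2⟩

lemma filter_chord_eq (B : Bouquet n E) {i j : Fin (2 * n)} (hij : i ≠ j)
    (h : B.chord i = B.chord j) :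
    (Finset.univ.filter fun k => B.chord k = B.chord i) = {i, j} := by
  symm
  apply Finset.eq_of_subset_of_card_le
  · intro k hk
    simp only [Finset.mem_insert, Finset.mem_singleton] at hk
    rcases hk with rfl | rfl <;> simp [h]
  · rw [B.fiber_two, Finset.card_pair hij]

lemma eq_or_eq_of_chord_eq (B : Bouquet n E) {i j k : Fin (2 * n)} (hij : i ≠ j)
    (h : B.chord i = B.chord j) (hk : B.chord k = B.chord i) : k = i ∨ k = j := by
  have : k ∈ Finset.univ.filter fun k => B.chord k = B.chord i := by simp [hk]
  simpa [B.filter_chord_eq hij h] using this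

lemma interlaced_iff (B : Bouquet n E) {i j : Fin (2 * n)} (hij : i < j)
    (h : B.chord i = B.chord j) (e : E) :
    B.Interlaced (B.chord i) e ↔
      (Finset.univ.filter fun k => B.chord k = e ∧ i < k ∧ k < j).card = 1 := by
  constructor
  · rintro ⟨-, i', j', hi', hj', hlt, hcard⟩
    have h1 := B.eq_or_eq_of_chord_eq hij.ne h hi'
    have h2 := B.eq_or_eq_of_chord_eq hij.ne h hj'
    have : i' = i ∧ j' = j := by lia
    rwa [this.1, this.2] at hcard
  · refine fun hcard => ⟨?_, i, j, rfl, h.symm, hij, hcard⟩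
    rintro rfl
    obtain ⟨k, hk⟩ := Finset.card_pos.1 (hcard ▸ Nat.one_pos)
    simp only [Finset.mem_filter, Finset.mem_univ, true_and] at hk
    have := B.eq_or_eq_of_chord_eq hij.ne h hk.1
    lia

/-- The sum of a chord weighting over the first `m` positions. -/
def prefixSum (B : Bouquet n E) (x : E → ZMod 2) (m : ℕ) : ZMod 2 :=
  ∑ k : Fin (2 * n) with k.val < m, x (B.chord k)

lemma prefixSum_zero (B : Bouquet n E) (x : E → ZMod 2) : B.prefixSum x 0 = 0 := by
  simp [prefixSum]

lemma prefixSum_succ (B : Bouquet n E) (x : E → ZMod 2) (i : Fin (2 * n)) :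
    B.prefixSum x (i + 1) = B.prefixSum x i + x (B.chord i) := by
  have : (Finset.univ.filter fun k : Fin (2 * n) => k.val < i.val + 1) =
      insert i (Finset.univ.filter fun k : Fin (2 * n) => k.val < i.val) := by
    ext k
    simp only [Finset.mem_filter, Finset.mem_univ, true_and, Finset.mem_insert]
    lia
  rw [prefixSum, this, Finset.sum_insert (by simp), add_comm, prefixSum]

lemma sum_filter_chord (B : Bouquet n E) (x : E → ZMod 2) (p : Fin (2 * n) → Prop)
    [DecidablePred p] :
    ∑ k with p k, x (B.chord k) =
      ∑ e, ((Finset.univ.filter fun k => B.chord k = e ∧ p k).card : ZMod 2) * x e := by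
  rw [← Finset.sum_fiberwise _ B.chord]
  refine Finset.sum_congr rfl fun e _ => ?_
  rw [Finset.filter_filter, Finset.sum_congr rfl (g := fun _ => x e)]
  · simp [and_comm]
  · intro k hk
    rw [(Finset.mem_filter.1 hk).2.2]

lemma prefixSum_top (B : Bouquet n E) (x : E → ZMod 2) : B.prefixSum x (2 * n) = 0 := by
  rw [prefixSum, B.sum_filter_chord]
  refine Finset.sum_eq_zero fun e _ => ?_
  have : (Finset.univ.filter fun k : Fin (2 * n) => B.chord k = e ∧ k.val < 2 * n).card = 2 := by
    simpa using B.fiber_two e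
  rw [this, show ((2 : ℕ) : ZMod 2) = 0 from rfl, zero_mul]

open Classical in
/-- The sum of a chord weighting over the chords interlaced with `e`. -/
noncomputable def interlacedSum (B : Bouquet n E) (x : E → ZMod 2) (e : E) : ZMod 2 :=
  ∑ e', if B.Interlaced e e' then x e' else 0

lemma prefixSum_eq_add_interlacedSum (B : Bouquet n E) (x : E → ZMod 2) {i j : Fin (2 * n)}
    (hij : i < j) (h : B.chord i = B.chord j) :
    B.prefixSum x j = B.prefixSum x (i + 1) + B.interlacedSum x (B.chord i) := by
  have hsplit : B.prefixSum x j = B.prefixSum x (i + 1) +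
      ∑ k with i < k ∧ k < j, x (B.chord k) := by
    rw [prefixSum, prefixSum, ← Finset.sum_union]
    · congr 1
      ext k
      simp only [Finset.mem_filter, Finset.mem_univ, true_and, Finset.mem_union]
      lia
    · rw [Finset.disjoint_filter]
      intro k _ hk
      lia
  rw [hsplit, B.sum_filter_chord, interlacedSum]
  congr 1
  refine Finset.sum_congr rfl fun e _ => ?_
  rw [B.interlaced_iff hij h]
  have hle : (Finset.univ.filter fun k => B.chord k = e ∧ i < k ∧ k < j).card ≤ 2 :=
    (Finset.card_le_card fun k hk => by simp_all).trans (B.fiber_two e).le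
  generalize (Finset.univ.filter fun k => B.chord k = e ∧ i < k ∧ k < j).card = c at hle
  interval_cases c
  · simp
  · simp
  · rw [show ((2 : ℕ) : ZMod 2) = 0 from rfl]
    simp

/-- The kernel over `ZMod 2` of the adjacency matrix of the signed intersection graph, with
diagonal entry `1` exactly at the twisted chords. -/
def kernel (B : Bouquet n E) : Set (E → ZMod 2) :=
  {x | ∀ e, (if B.sign e then 0 else x e) + B.interlacedSum x e = 0}

/-- The function on boundary points with value `c` at `0⁻` which changes by `x e` across
each endpoint of the chord `e`. -/
def potential (B : Bouquet n E) (c : ZMod 2) (x : E → ZMod 2) (v : Fin (2 * n) × Bool) :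
    ZMod 2 :=
  c + B.prefixSum x (v.1 + v.2.toNat)

lemma potential_true (B : Bouquet n E) (c : ZMod 2) (x : E → ZMod 2) (i : Fin (2 * n)) :
    B.potential c x (i, true) = B.potential c x (i, false) + x (B.chord i) := by
  simp [potential, prefixSum_succ, add_assoc]

lemma potential_of_lt (B : Bouquet n E) (c : ZMod 2) (x : E → ZMod 2) {i j : Fin (2 * n)}
    (hij : i < j) (h : B.chord i = B.chord j) :
    B.potential c x (j, false) =
      B.potential c x (i, true) + B.interlacedSum x (B.chord i) := by
  simp [potential, B.prefixSum_eq_add_interlacedSum x hij h, add_assoc]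

lemma potential_next (B : Bouquet n E) (c : ZMod 2) (x : E → ZMod 2) {i j : Fin (2 * n)}
    (h : j.val = (i.val + 1) % (2 * n)) :
    B.potential c x (i, true) = B.potential c x (j, false) := by
  simp only [potential, Bool.toNat_true, Bool.toNat_false, add_zero]
  rcases Nat.lt_or_ge (i.val + 1) (2 * n) with hi | hi
  · rw [h, Nat.mod_eq_of_lt hi]
  · have hi' : i.val + 1 = 2 * n := by lia
    rw [h, hi', Nat.mod_self, prefixSum_zero, prefixSum_top]

lemma exists_lt_chord_eq (B : Bouquet n E) (e : E) :
    ∃ i j, i < j ∧ B.chord i = e ∧ B.chord j = e := by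
  obtain ⟨i, j, hij, h⟩ := Finset.card_eq_two.1 (B.fiber_two e)
  have hi : B.chord i = e := by
    have : i ∈ Finset.univ.filter fun i => B.chord i = e := by simp [h]
    simpa using this
  have hj : B.chord j = e := by
    have : j ∈ Finset.univ.filter fun i => B.chord i = e := by simp [h]
    simpa using this
  rcases lt_or_gt_of_ne hij with hlt | hlt
  · exact ⟨i, j, hlt, hi, hj⟩
  · exact ⟨j, i, hlt, hj, hi⟩

lemma boundaryGraph_adj_of_chord_eq (B : Bouquet n E) {i j : Fin (2 * n)} {b b' : Bool}
    (hij : i ≠ j) (h : B.chord i = B.chord j)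
    (hb : if B.sign (B.chord i) then b ≠ b' else b = b') :
    B.boundaryGraph.Adj (i, b) (j, b') := by
  rw [boundaryGraph, SimpleGraph.fromRel_adj]
  exact ⟨fun he => hij (congrArg Prod.fst he), Or.inl (Or.inr ⟨h, hij, hb⟩)⟩

lemma potential_chord (B : Bouquet n E) (c : ZMod 2) {x : E → ZMod 2} (hx : x ∈ B.kernel)
    {i j : Fin (2 * n)} {b b' : Bool} (hij : i ≠ j) (h : B.chord i = B.chord j)
    (hb : if B.sign (B.chord i) then b ≠ b' else b = b') :
    B.potential c x (i, b) = B.potential c x (j, b') := by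
  wlog hlt : i < j generalizing i j b b'
  · refine (this hij.symm h.symm ?_ (lt_of_le_of_ne (not_lt.1 hlt) hij.symm)).symm
    rw [← h]
    simpa only [ne_comm, eq_comm] using hb
  have hk := hx (B.chord i)
  have h1 := B.potential_of_lt c x hlt h
  have h2 := B.potential_true c x i
  have h3 := B.potential_true c x j
  rw [← h] at h3
  have h4 := CharTwo.add_self_eq_zero (x (B.chord i))
  cases hs : B.sign (B.chord i) <;> simp only [hs, if_true, if_false, Bool.false_eq_true] at hb hk
  · subst hb
    cases b <;> grind
  · cases b <;> cases b' <;> simp at hb <;> grind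

lemma potential_adj_iff (B : Bouquet n E) (c : ZMod 2) (x : E → ZMod 2) :
    (∀ v w, B.boundaryGraph.Adj v w → B.potential c x v = B.potential c x w) ↔
      x ∈ B.kernel := by
  constructor
  · intro hadj e
    obtain ⟨i, j, hij, rfl, h⟩ := B.exists_lt_chord_eq e
    have h1 := B.potential_of_lt c x hij h.symm
    have h2 := B.potential_true c x j
    rw [h] at h2
    have h4 := CharTwo.add_self_eq_zero (x (B.chord i))
    cases hs : B.sign (B.chord i)
    · have := hadj _ _ (B.boundaryGraph_adj_of_chord_eq (b := true) (b' := true) hij.ne h.symm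
        (by simp [hs]))
      simp
      grind
    · have := hadj _ _ (B.boundaryGraph_adj_of_chord_eq (b := true) (b' := false) hij.ne h.symm
        (by simp [hs]))
      simp
      grind
  · rintro hx ⟨i, b⟩ ⟨j, b'⟩ hadj
    rw [boundaryGraph, SimpleGraph.fromRel_adj] at hadj
    rcases hadj.2 with (⟨rfl, rfl, h⟩ | ⟨h, hij, hb⟩) | (⟨rfl, rfl, h⟩ | ⟨h, hij, hb⟩)
    · exact B.potential_next c x h
    · exact B.potential_chord c hx hij h hb
    · exact (B.potential_next c x h).symm
    · exact (B.potential_chord c hx hij h hb).symm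

lemma exists_potential_eq (B : Bouquet n E) (h : Fin (2 * n) × Bool → ZMod 2)
    (hadj : ∀ v w, B.boundaryGraph.Adj v w → h v = h w) :
    ∃ c x, B.potential c x = h := by
  rcases Nat.eq_zero_or_pos n with rfl | hn
  · exact ⟨0, 0, funext fun v => v.1.elim0⟩
  choose p hp using B.exists_chord_eq
  have hjump : ∀ i, h (i, true) = h (i, false) + (h (p (B.chord i), true) +
      h (p (B.chord i), false)) := by
    intro i
    by_cases hi : i = p (B.chord i)
    · rw [← hi]
      have := CharTwo.add_self_eq_zero (h (i, false))
      grind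
    · have hc := (hp (B.chord i)).symm
      have h4 := CharTwo.add_self_eq_zero (h (i, false))
      cases hs : B.sign (B.chord i)
      · have h1 := hadj _ _ (B.boundaryGraph_adj_of_chord_eq (b := true) (b' := true) hi hc
          (by simp [hs]))
        have h2 := hadj _ _ (B.boundaryGraph_adj_of_chord_eq (b := false) (b' := false) hi hc
          (by simp [hs]))
        grind
      · have h1 := hadj _ _ (B.boundaryGraph_adj_of_chord_eq (b := true) (b' := false) hi hc
          (by simp [hs]))
        have h2 := hadj _ _ (B.boundaryGraph_adj_of_chord_eq (b := false) (b' := true) hi hc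
          (by simp [hs]))
        have h5 := CharTwo.add_self_eq_zero (h (i, true))
        grind
  set c := h (⟨0, by lia⟩, false) with hc
  set x : E → ZMod 2 := fun e => h (p e, true) + h (p e, false) with hx
  have hminus : ∀ (m : ℕ) (hm : m < 2 * n),
      B.potential c x (⟨m, hm⟩, false) = h (⟨m, hm⟩, false) := by
    intro m
    induction m with
    | zero => intro hm; simp [potential, prefixSum_zero, hc]
    | succ m ih =>
      intro hm
      have hm' : m < 2 * n := by lia
      have hmod : m + 1 = (m + 1) % (2 * n) := (Nat.mod_eq_of_lt hm).symm
      have hσ : h (⟨m, hm'⟩, true) = h (⟨m + 1, hm⟩, false) := by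
        apply hadj
        rw [boundaryGraph, SimpleGraph.fromRel_adj]
        exact ⟨by simp, Or.inl (Or.inl ⟨rfl, rfl, hmod⟩)⟩
      rw [← B.potential_next c x (i := ⟨m, hm'⟩) hmod, potential_true, ih hm', ← hσ, hjump]
  refine ⟨c, x, funext ?_⟩
  rintro ⟨i, _ | _⟩
  · exact hminus i i.2
  · rw [potential_true, hminus i i.2, hjump]

lemma potential_injective (B : Bouquet n E) (hn : 0 < n) {c c' : ZMod 2} {x x' : E → ZMod 2}
    (h : B.potential c x = B.potential c' x') : c = c' ∧ x = x' := by
  constructor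
  · simpa [potential, prefixSum_zero] using congrFun h (⟨0, by lia⟩, false)
  · funext e
    obtain ⟨i, rfl⟩ := B.exists_chord_eq e
    have h1 := B.potential_true c x i
    rw [h, potential_true] at h1
    exact (add_left_cancel h1).symm

/-- The number of boundary components is one more than the dimension of the kernel. -/
theorem two_pow_numBoundary (B : Bouquet n E) (hn : 0 < n) :
    2 ^ B.numBoundary = 2 * Nat.card B.kernel := by
  let F : ZMod 2 × B.kernel →
      {h : Fin (2 * n) × Bool → ZMod 2 // ∀ v w, B.boundaryGraph.Adj v w → h v = h w} :=
    fun q => ⟨B.potential q.1 q.2, (B.potential_adj_iff q.1 q.2).2 q.2.2⟩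
  have hF : Function.Bijective F := by
    constructor
    · rintro ⟨c, x⟩ ⟨c', x'⟩ h
      obtain ⟨hc, hx⟩ := B.potential_injective hn (congrArg Subtype.val h)
      exact Prod.ext hc (Subtype.ext hx)
    · rintro ⟨h, hadj⟩
      obtain ⟨c, x, rfl⟩ := B.exists_potential_eq h hadj
      exact ⟨(c, ⟨x, (B.potential_adj_iff c x).1 hadj⟩), rfl⟩
  have h1 := Nat.card_congr (B.boundaryGraph.connectedComponentFunEquiv (ZMod 2))
  rw [← Nat.card_congr (Equiv.ofBijective F hF), Nat.card_prod, Nat.card_fun,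
    Nat.card_zmod] at h1
  exact h1

/-- The Euler genus depends only on the signed intersection graph. -/
theorem eulerGenus_eq {n₁ n₂ : ℕ} {E₁ E₂ : Type}
    [Fintype E₁] [DecidableEq E₁] [Fintype E₂] [DecidableEq E₂]
    (B₁ : Bouquet n₁ E₁) (B₂ : Bouquet n₂ E₂) (φ : E₁ ≃ E₂)
    (hint : ∀ e e' : E₁, e ≠ e' → (B₁.Interlaced e e' ↔ B₂.Interlaced (φ e) (φ e')))
    (hsign : ∀ e : E₁, B₁.sign e = B₂.sign (φ e)) :
    B₁.eulerGenus = B₂.eulerGenus := by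
  obtain rfl : n₁ = n₂ := by rw [B₁.card_eq, B₂.card_eq, Fintype.card_congr φ]
  unfold eulerGenus
  congr 1
  rcases Nat.eq_zero_or_pos n₁ with rfl | hn
  · have hcard (E : Type) [Fintype E] [DecidableEq E] (B : Bouquet 0 E) :
        B.numBoundary = 0 := by
      have : IsEmpty B.boundaryGraph.ConnectedComponent :=
        ⟨fun v => by
          obtain ⟨v, -⟩ := v.exists_rep
          exact v.1.elim0⟩
      exact Nat.card_of_isEmpty
    rw [hcard, hcard]
  have hint' : ∀ e e', B₁.Interlaced e e' ↔ B₂.Interlaced (φ e) (φ e') := by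
    intro e e'
    by_cases h : e = e'
    · subst h
      exact ⟨fun h => absurd rfl h.1, fun h => absurd rfl h.1⟩
    · exact hint e e' h
  have hsum : ∀ (x : E₂ → ZMod 2) (e : E₁),
      B₁.interlacedSum (x ∘ φ) e = B₂.interlacedSum x (φ e) := by
    intro x e
    classical
    refine Fintype.sum_equiv φ _ _ fun e' => ?_
    simp only [hint', Function.comp_apply]
  have hker : Nat.card B₂.kernel = Nat.card B₁.kernel := by
    refine Nat.card_congr ((φ.symm.arrowCongr (Equiv.refl _)).subtypeEquiv fun x => ?_)
    change _ ↔ x ∘ φ ∈ B₁.kernel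
    simp only [kernel, Set.mem_ofPred_eq, hsum, hsign, Function.comp_apply]
    exact φ.surjective.forall
  apply Nat.pow_right_injective le_rfl
  simp only [two_pow_numBoundary _ hn, hker]

end Bouquet

/-- Two bouquets with the same signed intersection graph have the same partial
Petrial polynomial. -/
theorem stmt1 {n₁ n₂ : ℕ} {E₁ E₂ : Type}
    [Fintype E₁] [DecidableEq E₁] [Fintype E₂] [DecidableEq E₂]
    (B₁ : Bouquet n₁ E₁) (B₂ : Bouquet n₂ E₂) (φ : E₁ ≃ E₂)
    (hint : ∀ e e' : E₁, e ≠ e' → (B₁.Interlaced e e' ↔ B₂.Interlaced (φ e) (φ e')))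
    (hsign : ∀ e : E₁, B₁.sign e = B₂.sign (φ e)) :
    B₁.petrialPoly = B₂.petrialPoly := by
  refine Fintype.sum_equiv φ.finsetCongr _ _ fun A => ?_
  congr 1
  refine Bouquet.eulerGenus_eq _ _ φ hint fun e => ?_
  simp [Bouquet.petrial, hsign]
end

section
/- Let B be a signed chord diagram on n ≥ 1 chords. Then ε(B^{×|A}) ≤ n for every subset A of chords, and there exists a subset A of chords with f(B^{×|A}) = 1, hence with ε(B^{×|A}) = n. Consequently the degree of the partial Petrial polynomial ∂ε^×_B(z) is exactly n. -/
open Finset Polynomial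

/-- A finite set stable under a fixed-point-free involution has even cardinality. -/
theorem Finset.even_card_of_involutive_of_ne {V : Type*} (s : V → V)
    (hs : Function.Involutive s) (hs' : ∀ x, s x ≠ x) (K : Finset V)
    (hK : ∀ x ∈ K, s x ∈ K) : Even K.card := by
  have h : ∑ _x ∈ K, (1 : ZMod 2) = 0 :=
    Finset.sum_involution (fun x _ => s x) (fun _ _ => by decide) (fun x _ _ => hs' x)
      (fun x hx => hK x hx) (fun x _ => hs x)
  rw [Finset.sum_const, nsmul_eq_mul, mul_one] at h
  exact (ZMod.natCast_eq_zero_iff_even).1 h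

namespace SimpleGraph

variable {V : Type*} {G G' : SimpleGraph V} {s t t' : V → V}

/-- If `G` is the union of the matchings `s` and `t`, and `G'` is the union of `s` and `t'`, where
`t'` differs from `t` only on two edges lying in different components of `G`, then the ends of
either edge remain connected in `G'`. -/
theorem reachable_matching_edge [Finite V]
    (hs : Function.Involutive s) (hs' : ∀ x, s x ≠ x)
    (ht : Function.Involutive t) (ht' : ∀ x, t x ≠ x)
    (hG : ∀ x y, G.Adj x y ↔ y = s x ∨ y = t x) (hG' : ∀ x y, G'.Adj x y ↔ y = s x ∨ y = t' x)
    {a c : V} (hac : ¬ G.Reachable a c)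
    (h : ∀ x, x ≠ a → x ≠ t a → x ≠ c → x ≠ t c → t' x = t x) :
    G'.Reachable a (t a) := by
  classical
  have := Fintype.ofFinite V
  by_contra hb
  set K : Finset V := Finset.univ.filter fun x => G.Reachable a x ∧ G'.Reachable a x with hKdef
  have hsK : ∀ x ∈ K, s x ∈ K := by
    intro x hx
    simp only [hKdef, Finset.mem_filter, Finset.mem_univ, true_and] at hx ⊢
    exact ⟨hx.1.trans ((hG _ _).2 (Or.inl rfl)).reachable,
      hx.2.trans ((hG' _ _).2 (Or.inl rfl)).reachable⟩
  have htK : ∀ x ∈ K.erase a, t x ∈ K.erase a := by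
    intro x hx
    simp only [hKdef, Finset.mem_erase, Finset.mem_filter, Finset.mem_univ, true_and] at hx ⊢
    obtain ⟨hxa, h1, h2⟩ := hx
    have hxb : x ≠ t a := by rintro rfl; exact hb h2
    have hxc : x ≠ c := by rintro rfl; exact hac h1
    have hxd : x ≠ t c := by
      rintro rfl
      exact hac (h1.trans ((hG c (t c)).2 (Or.inr rfl)).symm.reachable)
    refine ⟨fun e => hxb (by rw [← e, ht x]), h1.trans ((hG _ _).2 (Or.inr rfl)).reachable, ?_⟩
    exact h2.trans ((hG' _ _).2 (Or.inr (h x hxa hxb hxc hxd).symm)).reachable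
  have haK : a ∈ K := by simp [hKdef]
  have e1 := Finset.even_card_of_involutive_of_ne s hs hs' K hsK
  have e2 := Finset.even_card_of_involutive_of_ne t ht ht' _ htK
  rw [← Finset.card_erase_add_one haK] at e1
  exact (Nat.even_add_one.1 e1) e2

/-- Recombining two edges of one matching that lie in different components of a union of two
matchings merges these components. -/
theorem reachable_of_recombine [Finite V]
    (hs : Function.Involutive s) (hs' : ∀ x, s x ≠ x)
    (ht : Function.Involutive t) (ht' : ∀ x, t x ≠ x)
    (hG : ∀ x y, G.Adj x y ↔ y = s x ∨ y = t x) (hG' : ∀ x y, G'.Adj x y ↔ y = s x ∨ y = t' x)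
    {a c : V} (hac : ¬ G.Reachable a c)
    (h : ∀ x, x ≠ a → x ≠ t a → x ≠ c → x ≠ t c → t' x = t x) (hta : t' a = t c) :
    G'.Reachable a c ∧ ∀ x y, G.Reachable x y → G'.Reachable x y := by
  have hab := reachable_matching_edge hs hs' ht ht' hG hG' hac h
  have hcd := reachable_matching_edge hs hs' ht ht' hG hG' (fun r => hac r.symm)
    (fun x h1 h2 h3 h4 => h x h3 h4 h1 h2)
  have had : G'.Reachable a (t c) := ((hG' _ _).2 (Or.inr hta.symm)).reachable
  refine ⟨had.trans hcd.symm, ?_⟩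
  have hadj : ∀ x y, G.Adj x y → G'.Reachable x y := by
    intro x y hxy
    rcases (hG x y).1 hxy with rfl | rfl
    · exact ((hG' _ _).2 (Or.inl rfl)).reachable
    · by_cases h1 : x = a
      · subst h1; exact hab
      by_cases h2 : x = t a
      · subst h2; rw [ht a]; exact hab.symm
      by_cases h3 : x = c
      · subst h3; exact hcd
      by_cases h4 : x = t c
      · subst h4; rw [ht c]; exact hcd.symm
      exact ((hG' _ _).2 (Or.inr (h x h1 h2 h3 h4).symm)).reachable
  rintro x y ⟨w⟩
  induction w with
  | nil => exact Reachable.refl _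
  | cons h1 _ ih => exact (hadj _ _ h1).trans ih

end SimpleGraph

namespace Bouquet

variable {n : ℕ} {E : Type} [Fintype E] [DecidableEq E]

theorem existsUnique_mate (B : Bouquet n E) (i : Fin (2 * n)) :
    ∃! j, j ≠ i ∧ B.chord j = B.chord i := by
  obtain ⟨x, y, hxy, h⟩ := Finset.card_eq_two.1 (B.fiber_two (B.chord i))
  have hm : ∀ k, B.chord k = B.chord i ↔ k = x ∨ k = y := fun k => by
    simpa using Finset.ext_iff.1 h k
  rcases (hm i).1 rfl with rfl | rfl
  · exact ⟨y, ⟨hxy.symm, (hm y).2 (Or.inr rfl)⟩,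
      fun k hk => ((hm k).1 hk.2).resolve_left hk.1⟩
  · exact ⟨x, ⟨hxy, (hm x).2 (Or.inl rfl)⟩,
      fun k hk => ((hm k).1 hk.2).resolve_right hk.1⟩

/-- The other endpoint of the chord ending at `i`. -/
noncomputable def mate (B : Bouquet n E) (i : Fin (2 * n)) : Fin (2 * n) :=
  (B.existsUnique_mate i).choose

theorem mate_ne (B : Bouquet n E) (i : Fin (2 * n)) : B.mate i ≠ i :=
  (B.existsUnique_mate i).choose_spec.1.1

theorem chord_mate (B : Bouquet n E) (i : Fin (2 * n)) : B.chord (B.mate i) = B.chord i :=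
  (B.existsUnique_mate i).choose_spec.1.2

theorem eq_mate (B : Bouquet n E) {i j : Fin (2 * n)} (h : j ≠ i)
    (h' : B.chord j = B.chord i) : j = B.mate i :=
  (B.existsUnique_mate i).choose_spec.2 j ⟨h, h'⟩

theorem mate_mate (B : Bouquet n E) (i : Fin (2 * n)) : B.mate (B.mate i) = i :=
  (B.eq_mate (B.mate_ne i).symm (B.chord_mate i).symm).symm

/-- The matching `τ` along the chords. -/
noncomputable def chordMatching (B : Bouquet n E) (x : Fin (2 * n) × Bool) :
    Fin (2 * n) × Bool :=
  (B.mate x.1, if B.sign (B.chord x.1) then !x.2 else x.2)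

theorem chordMatching_involutive (B : Bouquet n E) : Function.Involutive B.chordMatching := by
  rintro ⟨i, b⟩
  simp only [chordMatching, mate_mate, chord_mate]
  cases B.sign (B.chord i) <;> simp

theorem chordMatching_ne (B : Bouquet n E) (x : Fin (2 * n) × Bool) : B.chordMatching x ≠ x :=
  fun h => B.mate_ne x.1 (congrArg Prod.fst h)

/-- The matching `σ` joining `i⁺` to `(i+1)⁻`. -/
def arcMatching [NeZero (2 * n)] (x : Fin (2 * n) × Bool) : Fin (2 * n) × Bool :=
  if x.2 then (x.1 + 1, false) else (x.1 - 1, true)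

theorem arcMatching_involutive [NeZero (2 * n)] :
    Function.Involutive (arcMatching (n := n)) := by
  rintro ⟨i, b⟩
  cases b <;> simp [arcMatching]

theorem arcMatching_ne [NeZero (2 * n)] (x : Fin (2 * n) × Bool) : arcMatching x ≠ x := by
  obtain ⟨i, b⟩ := x
  cases b <;> simp [arcMatching]

theorem val_eq_succ_mod_iff [NeZero (2 * n)] (i j : Fin (2 * n)) :
    j.val = (i.val + 1) % (2 * n) ↔ j = i + 1 := by
  rw [Fin.ext_iff, Fin.val_add, Fin.val_one', Nat.add_mod_mod]

theorem boundaryGraph_adj_iff [NeZero (2 * n)] (B : Bouquet n E) (x y : Fin (2 * n) × Bool) :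
    B.boundaryGraph.Adj x y ↔ y = arcMatching x ∨ y = B.chordMatching x := by
  have hmate : ∀ i j, (B.chord i = B.chord j ∧ i ≠ j) ↔ j = B.mate i := fun i j =>
    ⟨fun h => B.eq_mate h.2.symm h.1.symm,
      fun h => h ▸ ⟨(B.chord_mate i).symm, (B.mate_ne i).symm⟩⟩
  obtain ⟨i, b⟩ := x
  obtain ⟨j, c⟩ := y
  simp only [boundaryGraph, SimpleGraph.fromRel_adj, val_eq_succ_mod_iff]
  constructor
  · rintro ⟨-, (⟨rfl, rfl, rfl⟩ | ⟨h1, h2, h3⟩) | (⟨rfl, rfl, rfl⟩ | ⟨h1, h2, h3⟩)⟩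
    · left; simp [arcMatching]
    · right
      obtain rfl := (hmate i j).1 ⟨h1, h2⟩
      simp only [chordMatching]
      cases hs : B.sign (B.chord i) <;> cases b <;> cases c <;> simp_all
    · left; simp [arcMatching]
    · right
      obtain rfl := (hmate i j).1 ⟨h1.symm, h2.symm⟩
      rw [chord_mate] at h3
      simp only [chordMatching]
      cases hs : B.sign (B.chord i) <;> cases b <;> cases c <;> simp_all
  · rintro (h | h)
    · refine ⟨fun h' => arcMatching_ne (i, b) (h.symm.trans h'.symm), ?_⟩
      cases b <;> simp_all [arcMatching]
    · refine ⟨fun h' => B.chordMatching_ne (i, b) (h.symm.trans h'.symm), Or.inl (Or.inr ?_)⟩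
      simp only [chordMatching, Prod.mk.injEq] at h
      obtain ⟨h1, h2⟩ := (hmate i j).2 h.1
      refine ⟨h1, h2, ?_⟩
      rw [h.2]
      cases B.sign (B.chord i) <;> simp

/-- A boundary graph in which `i⁺` and `i⁻` are always connected is connected. -/
theorem boundaryGraph_connected [NeZero (2 * n)] (B : Bouquet n E)
    (h : ∀ i, B.boundaryGraph.Reachable (i, true) (i, false)) : B.boundaryGraph.Connected := by
  have h0 : ∀ k (hk : k < 2 * n), B.boundaryGraph.Reachable (0, true) (⟨k, hk⟩, true) := by
    intro k
    induction k with
    | zero => intro hk; exact SimpleGraph.Reachable.refl _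
    | succ k ih =>
      intro hk
      have hadj : B.boundaryGraph.Adj (⟨k, by omega⟩, true) (⟨k + 1, hk⟩, false) := by
        rw [boundaryGraph_adj_iff]
        left
        simp only [arcMatching, if_true, Prod.mk.injEq, and_true]
        rw [← val_eq_succ_mod_iff]
        exact (Nat.mod_eq_of_lt hk).symm
      exact (ih (by omega)).trans (hadj.reachable.trans (h _).symm)
  have h1 : ∀ x, B.boundaryGraph.Reachable (0, true) x := by
    rintro ⟨i, b⟩
    cases b
    · exact (h0 i.1 i.2).trans (h i)
    · exact h0 i.1 i.2
  exact { preconnected := fun x y => (h1 x).symm.trans (h1 y), nonempty := ⟨(0, true)⟩ }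

theorem mate_petrial (B : Bouquet n E) (A : Finset E) (i : Fin (2 * n)) :
    (B.petrial A).mate i = B.mate i :=
  B.eq_mate ((B.petrial A).mate_ne i) ((B.petrial A).chord_mate i)

theorem petrial_sign_symmDiff (B : Bouquet n E) (A : Finset E) (e e' : E) :
    (B.petrial (symmDiff A {e})).sign e' =
      if e' = e then !(B.petrial A).sign e' else (B.petrial A).sign e' := by
  by_cases h : e' = e <;> by_cases h' : e' ∈ A <;>
    simp_all [petrial, Finset.mem_symmDiff]

/-- Flipping the sign of a chord that meets two boundary components merges them. -/
theorem reachable_petrial_symmDiff [NeZero (2 * n)] (B : Bouquet n E) (A : Finset E)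
    {i : Fin (2 * n)} (hi : ¬ (B.petrial A).boundaryGraph.Reachable (i, true) (i, false)) :
    (B.petrial (symmDiff A {B.chord i})).boundaryGraph.Reachable (i, true) (i, false) ∧
    ∀ x y, (B.petrial A).boundaryGraph.Reachable x y →
      (B.petrial (symmDiff A {B.chord i})).boundaryGraph.Reachable x y := by
  refine SimpleGraph.reachable_of_recombine arcMatching_involutive arcMatching_ne
    (B.petrial A).chordMatching_involutive (B.petrial A).chordMatching_ne
    (boundaryGraph_adj_iff _) (boundaryGraph_adj_iff _) hi ?_ ?_
  · rintro ⟨k, b⟩ h1 h2 h3 h4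
    have hki : k ≠ i := by
      rintro rfl
      cases b <;> simp_all
    have hkm : k ≠ B.mate i := by
      rintro rfl
      simp only [chordMatching, mate_petrial] at h2 h4
      cases hs : (B.petrial A).sign ((B.petrial A).chord i) <;> cases b <;> simp_all
    have hc : B.chord k ≠ B.chord i := fun h => hkm (B.eq_mate hki h)
    simp only [chordMatching, mate_petrial]
    change (_, if (B.petrial _).sign (B.chord k) then _ else _) =
      (_, if (B.petrial _).sign (B.chord k) then _ else _)
    rw [petrial_sign_symmDiff, if_neg hc]
  · simp only [chordMatching, mate_petrial]
    change (_, if (B.petrial _).sign (B.chord i) then _ else _) =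
      (_, if (B.petrial _).sign (B.chord i) then _ else _)
    rw [petrial_sign_symmDiff, if_pos rfl]
    cases (B.petrial A).sign (B.chord i) <;> simp

theorem exists_petrial_connected [NeZero (2 * n)] (B : Bouquet n E) :
    ∃ A : Finset E, (B.petrial A).boundaryGraph.Connected := by
  let R (A : Finset E) : Set ((Fin (2 * n) × Bool) × (Fin (2 * n) × Bool)) :=
    {p | (B.petrial A).boundaryGraph.Reachable p.1 p.2}
  obtain ⟨A, hA⟩ := Finite.exists_max fun A => (R A).ncard
  refine ⟨A, boundaryGraph_connected _ fun i => ?_⟩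
  by_contra hi
  obtain ⟨h1, h2⟩ := B.reachable_petrial_symmDiff A hi
  refine (hA (symmDiff A {B.chord i})).not_gt (Set.ncard_lt_ncard ?_ (Set.toFinite _))
  exact (Set.ssubset_iff_of_subset fun p hp => h2 _ _ hp).2 ⟨((i, true), (i, false)), h1, hi⟩

theorem numBoundary_eq_one (B : Bouquet n E) (h : B.boundaryGraph.Connected) :
    B.numBoundary = 1 := by
  have := h.nonempty
  have := h.preconnected.subsingleton_connectedComponent
  exact Nat.card_unique

theorem numBoundary_pos [NeZero (2 * n)] (B : Bouquet n E) : 0 < B.numBoundary := by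
  have : Nonempty B.boundaryGraph.ConnectedComponent :=
    ⟨B.boundaryGraph.connectedComponentMk (0, true)⟩
  exact Nat.card_pos

end Bouquet

/-- For a bouquet on `n ≥ 1` chords: every partial Petrial has Euler genus at most `n`,
some partial Petrial has exactly one boundary component (hence Euler genus exactly `n`),
and consequently the partial Petrial polynomial has degree exactly `n`. -/
theorem stmt3 {n : ℕ} (hn : 1 ≤ n) {E : Type} [Fintype E] [DecidableEq E]
    (B : Bouquet n E) :
    (∀ A : Finset E, (B.petrial A).eulerGenus ≤ n) ∧
    (∃ A : Finset E, (B.petrial A).numBoundary = 1 ∧ (B.petrial A).eulerGenus = n) ∧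
    B.petrialPoly.natDegree = n := by
  have : NeZero (2 * n) := ⟨by omega⟩
  have hle : ∀ A : Finset E, (B.petrial A).eulerGenus ≤ n := fun A => by
    have := (B.petrial A).numBoundary_pos
    unfold Bouquet.eulerGenus
    omega
  obtain ⟨A, hA⟩ := B.exists_petrial_connected
  have hf := Bouquet.numBoundary_eq_one _ hA
  have hε : (B.petrial A).eulerGenus = n := by
    unfold Bouquet.eulerGenus
    omega
  refine ⟨hle, ⟨A, hf, hε⟩, le_antisymm ?_ (le_natDegree_of_ne_zero ?_)⟩
  · exact natDegree_sum_le_of_forall_le _ _ fun A _ => (natDegree_X_pow_le _).trans (hle A)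
  · rw [Bouquet.petrialPoly, finsetSum_coeff]
    refine (Finset.sum_pos' (fun C _ => ?_) ⟨A, Finset.mem_univ _, ?_⟩).ne'
    · rw [coeff_X_pow]
      split_ifs <;> simp
    · simp [hε]
end

section
/- For every signed chord diagram B on a finite chord set E, the set of values {ε(B^{×|A}) : A ⊆ E} is a set of consecutive integers; equivalently, the partial Petrial polynomial ∂ε^×_B(z) is interpolating: if it has nonzero coefficients in degrees i and j with i < j, then it has a nonzero coefficient in every degree k with i ≤ k ≤ j. -/
open Finset Polynomial

/-- A spanning supergraph has at most as many connected components. -/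
theorem SimpleGraph.card_connectedComponent_le_of_le {V : Type*} [Finite V]
    {G K : SimpleGraph V} (h : G ≤ K) :
    Nat.card K.ConnectedComponent ≤ Nat.card G.ConnectedComponent := by
  refine Nat.card_le_card_of_surjective
    (fun c : G.ConnectedComponent => c.map (SimpleGraph.Hom.ofLE h)) ?_
  intro c
  induction c using SimpleGraph.ConnectedComponent.ind with
  | h v => exact ⟨G.connectedComponentMk v, rfl⟩

open Classical in
/-- If every edge of `K` either stays inside a component of `G` or joins the components of
`u` and `v`, then passing from `G` to `K` loses at most one component. -/
theorem SimpleGraph.card_connectedComponent_le_add_one {V : Type*} [Finite V]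
    {G K : SimpleGraph V} (u v : V)
    (h : ∀ x y, K.Adj x y → G.Reachable x y ∨ (G.Reachable x u ∧ G.Reachable y v) ∨
      (G.Reachable x v ∧ G.Reachable y u)) :
    Nat.card G.ConnectedComponent ≤ Nat.card K.ConnectedComponent + 1 := by
  let g : V → G.ConnectedComponent := fun x =>
    if G.connectedComponentMk x = G.connectedComponentMk v then G.connectedComponentMk u
    else G.connectedComponentMk x
  have hadj : ∀ x y, K.Adj x y → g x = g y := by
    intro x y hxy
    simp only [g]
    rcases h x y hxy with h | ⟨h₁, h₂⟩ | ⟨h₁, h₂⟩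
    · rw [SimpleGraph.ConnectedComponent.sound h]
    · rw [SimpleGraph.ConnectedComponent.sound h₁, SimpleGraph.ConnectedComponent.sound h₂]
      simp
    · rw [SimpleGraph.ConnectedComponent.sound h₁, SimpleGraph.ConnectedComponent.sound h₂]
      simp
  have hwalk : ∀ x y (p : K.Walk x y), g x = g y := by
    intro x y p
    induction p with
    | nil => rfl
    | cons hxy _ ih => exact (hadj _ _ hxy).trans ih
  let r : K.ConnectedComponent → G.ConnectedComponent :=
    SimpleGraph.ConnectedComponent.lift g fun x y p _ => hwalk x y p
  rw [← Finite.card_option]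
  refine Nat.card_le_card_of_surjective
    (fun o : Option K.ConnectedComponent => o.elim (G.connectedComponentMk v) r) ?_
  intro c
  induction c using SimpleGraph.ConnectedComponent.ind with
  | h x =>
    by_cases hx : G.connectedComponentMk x = G.connectedComponentMk v
    · exact ⟨none, hx.symm⟩
    · exact ⟨some (K.connectedComponentMk x), if_neg hx⟩

namespace Bouquet

variable {n : ℕ} {E : Type} [Fintype E] [DecidableEq E]

/-- Changing the sign of a single chord adds at most one boundary component. -/
theorem numBoundary_le_add_one {B B' : Bouquet n E} (e : E) (hchord : B.chord = B'.chord)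
    (hsign : ∀ e', e' ≠ e → B.sign e' = B'.sign e') :
    B.numBoundary ≤ B'.numBoundary + 1 := by
  obtain ⟨a, b, hab, hfib⟩ := Finset.card_eq_two.mp (B.fiber_two e)
  have hmem : ∀ i, B.chord i = e ↔ i = a ∨ i = b := fun i => by
    simpa using Finset.ext_iff.mp hfib i
  have ha : B.chord a = e := (hmem a).2 (Or.inl rfl)
  have hb : B.chord b = e := (hmem b).2 (Or.inr rfl)
  have hedge : ∀ s t : Bool, (if B.sign e then s ≠ t else s = t) →
      B.boundaryGraph.Reachable (a, s) (b, t) := by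
    intro s t hst
    refine SimpleGraph.Adj.reachable ?_
    rw [boundaryGraph, SimpleGraph.fromRel_adj]
    refine ⟨fun h => hab (congrArg Prod.fst h), Or.inl (Or.inr ⟨ha.trans hb.symm, hab, ?_⟩)⟩
    rwa [ha]
  have hcross : ∀ s t : Bool, B.boundaryGraph.Reachable (a, s) (b, t) ∨
      (B.boundaryGraph.Reachable (a, s) (a, true) ∧
        B.boundaryGraph.Reachable (b, t) (b, B.sign e)) ∨
      (B.boundaryGraph.Reachable (a, s) (b, B.sign e) ∧
        B.boundaryGraph.Reachable (b, t) (a, true)) := by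
    intro s t
    by_cases hst : if B.sign e then s ≠ t else s = t
    · exact Or.inl (hedge s t hst)
    · right
      cases s
      · exact Or.inr ⟨hedge _ _ (by cases h : B.sign e <;> simp),
          (hedge _ _ (by cases h : B.sign e <;> cases t <;> simp_all)).symm⟩
      · have : t = B.sign e := by cases h : B.sign e <;> cases t <;> simp_all
        subst this
        exact Or.inl ⟨SimpleGraph.Reachable.refl _, SimpleGraph.Reachable.refl _⟩
  have hrel : ∀ x y : Fin (2 * n) × Bool,
      ((x.2 = true ∧ y.2 = false ∧ y.1.val = (x.1.val + 1) % (2 * n)) ∨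
        (B'.chord x.1 = B'.chord y.1 ∧ x.1 ≠ y.1 ∧
          (if B'.sign (B'.chord x.1) then x.2 ≠ y.2 else x.2 = y.2))) → x ≠ y →
      B.boundaryGraph.Reachable x y ∨
      (B.boundaryGraph.Reachable x (a, true) ∧
        B.boundaryGraph.Reachable y (b, B.sign e)) ∨
      (B.boundaryGraph.Reachable x (b, B.sign e) ∧
        B.boundaryGraph.Reachable y (a, true)) := by
    rintro ⟨i, s⟩ ⟨j, t⟩ (h | ⟨hc, hij, hs⟩) hne
    · exact Or.inl (SimpleGraph.Adj.reachable
        ((SimpleGraph.fromRel_adj _ _ _).2 ⟨hne, Or.inl (Or.inl h)⟩))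
    · rw [← hchord] at hc hs
      by_cases hi : B.chord i = e
      · have hj : B.chord j = e := hc.symm.trans hi
        rcases (hmem i).1 hi with rfl | rfl <;> rcases (hmem j).1 hj with rfl | rfl
        · exact absurd rfl hij
        · exact hcross s t
        · rcases hcross t s with h | ⟨h₁, h₂⟩ | ⟨h₁, h₂⟩
          · exact Or.inl h.symm
          · exact Or.inr (Or.inr ⟨h₂, h₁⟩)
          · exact Or.inr (Or.inl ⟨h₂, h₁⟩)
        · exact absurd rfl hij
      · rw [← hsign _ hi] at hs
        exact Or.inl (SimpleGraph.Adj.reachable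
          ((SimpleGraph.fromRel_adj _ _ _).2 ⟨hne, Or.inl (Or.inr ⟨hc, hij, hs⟩)⟩))
  refine (SimpleGraph.card_connectedComponent_le_add_one
    (K := B.boundaryGraph ⊔ B'.boundaryGraph) (a, true) (b, B.sign e) ?_).trans
    (Nat.add_le_add_right (SimpleGraph.card_connectedComponent_le_of_le le_sup_right) 1)
  rintro x y (h | h)
  · exact Or.inl h.reachable
  · obtain ⟨hne, h | h⟩ := (SimpleGraph.fromRel_adj _ _ _).1 h
    · exact hrel x y h hne
    · rcases hrel y x h hne.symm with h | ⟨h₁, h₂⟩ | ⟨h₁, h₂⟩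
      · exact Or.inl h.symm
      · exact Or.inr (Or.inr ⟨h₂, h₁⟩)
      · exact Or.inr (Or.inl ⟨h₂, h₁⟩)

/-- Adding a chord to the twisted set changes the Euler genus by at most one. -/
theorem eulerGenus_petrial_insert (B : Bouquet n E) (e : E) (A : Finset E) :
    (B.petrial (insert e A)).eulerGenus ≤ (B.petrial A).eulerGenus + 1 ∧
      (B.petrial A).eulerGenus ≤ (B.petrial (insert e A)).eulerGenus + 1 := by
  have hsign : ∀ e', e' ≠ e → (B.petrial A).sign e' = (B.petrial (insert e A)).sign e' := by
    intro e' he'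
    simp [petrial, he']
  have h₁ := numBoundary_le_add_one (B := B.petrial A) (B' := B.petrial (insert e A)) e rfl hsign
  have h₂ := numBoundary_le_add_one (B := B.petrial (insert e A)) (B' := B.petrial A) e rfl
    fun e' he' => (hsign e' he').symm
  unfold eulerGenus
  omega

theorem petrialPoly_coeff_ne_zero_iff (B : Bouquet n E) (k : ℕ) :
    B.petrialPoly.coeff k ≠ 0 ↔ ∃ A : Finset E, (B.petrial A).eulerGenus = k := by
  have : B.petrialPoly.coeff k =
      ((Finset.univ.filter fun A : Finset E => k = (B.petrial A).eulerGenus).card : ℤ) := by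
    simp [petrialPoly, Polynomial.finsetSum_coeff, Polynomial.coeff_X_pow]
  rw [this, Nat.cast_ne_zero, Finset.card_ne_zero]
  simp [Finset.Nonempty, eq_comm]

end Bouquet

/-- A function on finsets that changes by at most one under insertion takes every value between
any two of its values. -/
theorem Finset.exists_eq_of_insert_le_add_one {α : Type*} [DecidableEq α] (g : Finset α → ℕ)
    (hg : ∀ a S, g (insert a S) ≤ g S + 1 ∧ g S ≤ g (insert a S) + 1) {S T : Finset α} {k : ℕ}
    (hS : g S ≤ k) (hT : k ≤ g T) : ∃ U, g U = k := by
  by_contra! hne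
  have key : ∀ U, g U < k ↔ g ∅ < k := by
    intro U
    induction U using Finset.induction_on with
    | empty => rfl
    | insert a U _ ih =>
      rw [← ih]
      have := hg a U
      have := hne U
      have := hne (insert a U)
      omega
  have := hne S
  have := key S
  have := key T
  omega

/-- The partial Petrial polynomial is interpolating: if it has nonzero coefficients in
degrees `i` and `j`, then it has a nonzero coefficient in every degree between them. -/
theorem stmt5 {n : ℕ} {E : Type} [Fintype E] [DecidableEq E] (B : Bouquet n E) :
    ∀ i j k : ℕ, i ≤ k → k ≤ j →
      B.petrialPoly.coeff i ≠ 0 → B.petrialPoly.coeff j ≠ 0 →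
      B.petrialPoly.coeff k ≠ 0 := by
  intro i j k hik hkj hi hj
  rw [Bouquet.petrialPoly_coeff_ne_zero_iff] at hi hj ⊢
  obtain ⟨S, rfl⟩ := hi
  obtain ⟨T, rfl⟩ := hj
  exact Finset.exists_eq_of_insert_le_add_one (fun A => (B.petrial A).eulerGenus)
    B.eulerGenus_petrial_insert hik hkj
end

section
/- Let B be a prime signed chord diagram on n ≥ 2 chords, i.e. one whose intersection graph I(B) is connected. Then f(B) ≤ n. -/
open Finset Polynomial

namespace Bouquet

variable {n : ℕ} {E : Type} [Fintype E] [DecidableEq E]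

lemma card_chords (B : Bouquet n E) : Fintype.card E = n := by
  have h := Finset.card_eq_sum_card_fiberwise (f := B.chord) (s := Finset.univ)
    (t := Finset.univ) (fun _ _ => Finset.mem_coe.2 (Finset.mem_univ _))
  simp only [B.fiber_two, Finset.card_univ, Fintype.card_fin, Finset.sum_const,
    smul_eq_mul] at h
  omega

/-- A `ZMod 2`-valued function on the boundary components, seen as a function on points. -/
def lift (B : Bouquet n E) (c : B.boundaryGraph.ConnectedComponent → ZMod 2)
    (x : Fin (2 * n) × Bool) : ZMod 2 :=
  c (B.boundaryGraph.connectedComponentMk x)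

variable (B : Bouquet n E) (c : B.boundaryGraph.ConnectedComponent → ZMod 2)

lemma lift_eq_of_adj {x y : Fin (2 * n) × Bool} (h : B.boundaryGraph.Adj x y) :
    B.lift c x = B.lift c y :=
  congrArg c (SimpleGraph.ConnectedComponent.sound h.reachable)

lemma lift_succ {m : ℕ} (hm : m + 1 < 2 * n) :
    B.lift c (⟨m + 1, hm⟩, false) = B.lift c (⟨m, by omega⟩, true) := by
  refine (lift_eq_of_adj B c ?_).symm
  refine (SimpleGraph.fromRel_adj _ _ _).2 ⟨by simp, Or.inl (Or.inl ⟨rfl, rfl, ?_⟩)⟩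
  exact (Nat.mod_eq_of_lt hm).symm

lemma lift_chord {i j : Fin (2 * n)} (hij : i ≠ j) (h : B.chord i = B.chord j) (b : Bool) :
    B.lift c (i, b) = B.lift c (j, if B.sign (B.chord i) then !b else b) := by
  refine lift_eq_of_adj B c ?_
  refine (SimpleGraph.fromRel_adj _ _ _).2 ⟨by simp [hij], Or.inl (Or.inr ⟨h, hij, ?_⟩)⟩
  cases B.sign (B.chord i) <;> simp

/-- The jump of a function on boundary components across an endpoint of a chord. -/
def jump (i : Fin (2 * n)) : ZMod 2 :=
  B.lift c (i, true) + B.lift c (i, false)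

lemma jump_eq_of_chord_eq {i j : Fin (2 * n)} (h : B.chord i = B.chord j) :
    B.jump c i = B.jump c j := by
  rcases eq_or_ne i j with rfl | hij
  · rfl
  · unfold jump
    rw [lift_chord B c hij h true, lift_chord B c hij h false]
    cases B.sign (B.chord i) <;> simp [add_comm]

lemma lift_true_eq (i : Fin (2 * n)) :
    B.lift c (i, true) = B.lift c (i, false) + B.jump c i := by
  unfold jump
  generalize B.lift c (i, true) = a
  generalize B.lift c (i, false) = b
  revert a b
  decide

/-- The jumps along all chords, together with the value at a base point. -/
noncomputable def jumpData (o : Fin (2 * n)) : (E → ZMod 2) × ZMod 2 :=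
  (fun e => B.jump c (B.exists_chord_eq e).choose, B.lift c (o, false))

lemma jump_eq_jumpData (o i : Fin (2 * n)) :
    B.jump c i = (B.jumpData c o).1 (B.chord i) :=
  jump_eq_of_chord_eq B c (B.exists_chord_eq (B.chord i)).choose_spec.symm

lemma jumpData_injective (h0 : 0 < 2 * n) :
    Function.Injective fun c => B.jumpData c ⟨0, h0⟩ := by
  intro c c' h
  have hj : ∀ i, B.jump c i = B.jump c' i := fun i => by
    rw [jump_eq_jumpData B c ⟨0, h0⟩, jump_eq_jumpData B c' ⟨0, h0⟩]
    exact congrFun (congrArg Prod.fst h) _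
  have hf : ∀ m (hm : m < 2 * n), B.lift c (⟨m, hm⟩, false) = B.lift c' (⟨m, hm⟩, false) := by
    intro m
    induction m with
    | zero => exact fun _ => congrArg Prod.snd h
    | succ m ih =>
      intro hm
      rw [lift_succ, lift_succ, lift_true_eq, lift_true_eq, ih, hj]
  funext q
  induction q using SimpleGraph.ConnectedComponent.ind with
  | h x =>
    obtain ⟨i, b⟩ := x
    change B.lift c (i, b) = B.lift c' (i, b)
    cases b
    · exact hf i i.2
    · rw [lift_true_eq, lift_true_eq, hj, hf i i.2]

/-- If the only jumps occur along `e`, the values on either side of an interval of positions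
differ by the number of endpoints of `e` in that interval. -/
lemma lift_eq_add_card {e : E} (hc : ∀ k, B.jump c k = if B.chord k = e then 1 else 0)
    (i : Fin (2 * n)) {m : ℕ} (him : i.val + 1 ≤ m) (hm : m < 2 * n) :
    B.lift c (⟨m, hm⟩, false) = B.lift c (i, true) +
      ((Finset.univ.filter fun k => B.chord k = e ∧ i < k ∧ k < ⟨m, hm⟩).card : ZMod 2) := by
  induction m, him using Nat.le_induction with
  | base =>
    rw [lift_succ, Finset.filter_false_of_mem]
    · simp
    · rintro k - ⟨-, h1, h2⟩
      simp only [Fin.lt_def] at h1 h2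
      omega
  | succ m him ih =>
    have hm' : m < 2 * n := by omega
    rw [lift_succ, lift_true_eq, ih hm', hc]
    split_ifs with he
    · have : (Finset.univ.filter fun k => B.chord k = e ∧ i < k ∧ k < ⟨m + 1, hm⟩) =
          insert ⟨m, hm'⟩ (Finset.univ.filter fun k => B.chord k = e ∧ i < k ∧ k < ⟨m, hm'⟩) := by
        ext k
        simp only [Finset.mem_filter, Finset.mem_univ, true_and, Finset.mem_insert, Fin.lt_def,
          Fin.ext_iff]
        constructor
        · rintro ⟨h1, h2, h3⟩
          rcases Nat.lt_succ_iff_lt_or_eq.1 h3 with h | h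
          · exact Or.inr ⟨h1, h2, h⟩
          · exact Or.inl h
        · rintro (h | ⟨h1, h2, h3⟩)
          · obtain rfl : k = ⟨m, hm'⟩ := Fin.ext h
            exact ⟨he, him, Nat.lt_succ_self m⟩
          · exact ⟨h1, h2, by omega⟩
      rw [this, Finset.card_insert_of_notMem (by simp)]
      push_cast
      ring
    · have : (Finset.univ.filter fun k => B.chord k = e ∧ i < k ∧ k < ⟨m + 1, hm⟩) =
          Finset.univ.filter fun k => B.chord k = e ∧ i < k ∧ k < ⟨m, hm'⟩ := by
        ext k
        simp only [Finset.mem_filter, Finset.mem_univ, true_and, Fin.lt_def]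
        refine and_congr_right fun h1 => and_congr_right fun h2 => ⟨fun h3 => ?_, fun h3 => by omega⟩
        refine lt_of_le_of_ne (Nat.lt_succ_iff.1 h3) fun h => he ?_
        obtain rfl : k = ⟨m, hm'⟩ := Fin.ext h
        exact h1
      rw [this, add_zero]

lemma not_forall_jump_eq_of_interlaced {e e' : E} (h : B.Interlaced e e') :
    ¬ ∀ k, B.jump c k = if B.chord k = e' then 1 else 0 := by
  intro hc
  obtain ⟨hne, i, j, hi, hj, hij, hcard⟩ := h
  have h1 := lift_eq_add_card B c hc i (Nat.succ_le_of_lt hij) j.2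
  rw [Fin.eta, hcard] at h1
  have h2 : B.lift c (j, true) = B.lift c (j, false) := by
    rw [lift_true_eq, hc, if_neg (by rwa [hj]), add_zero]
  have h3 := lift_chord B c hij.ne (hi.trans hj.symm) true
  have h4 : B.lift c (i, true) = B.lift c (j, false) := by
    rw [h3]
    cases B.sign (B.chord i) <;> simp [h2]
  rw [h4] at h1
  simp at h1

lemma exists_interlaced (hn : 2 ≤ n) (h : B.intersectionGraph.Connected) :
    ∃ e e', B.Interlaced e e' := by
  by_contra! hno
  have hbot : B.intersectionGraph = ⊥ := by
    ext a b
    simp [intersectionGraph, hno]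
  rw [hbot] at h
  have := SimpleGraph.preconnected_bot_iff_subsingleton.1 h.preconnected
  have := Fintype.card_le_one_iff_subsingleton.2 this
  rw [B.card_chords] at this
  omega

end Bouquet

/-- A prime bouquet (one with connected intersection graph) on `n ≥ 2` chords has at
most `n` boundary components. -/
theorem stmt6 {n : ℕ} (hn : 2 ≤ n) {E : Type} [Fintype E] [DecidableEq E]
    (B : Bouquet n E) (hprime : B.intersectionGraph.Connected) :
    B.numBoundary ≤ n := by
  classical
  obtain ⟨e, e', h⟩ := B.exists_interlaced hn hprime
  have h0 : 0 < 2 * n := by omega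
  have hns : ¬ Function.Surjective fun c => B.jumpData c ⟨0, h0⟩ := by
    intro hs
    obtain ⟨c, hc⟩ := hs (fun a => if a = e' then 1 else 0, 0)
    refine B.not_forall_jump_eq_of_interlaced c h fun k => ?_
    rw [B.jump_eq_jumpData c ⟨0, h0⟩]
    exact congrFun (congrArg Prod.fst hc) _
  let : Fintype B.boundaryGraph.ConnectedComponent := Fintype.ofFinite _
  have hlt := Fintype.card_lt_of_injective_not_surjective _ (B.jumpData_injective h0) hns
  rw [Fintype.card_prod, Fintype.card_fun, Fintype.card_fun, ZMod.card, B.card_chords,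
    ← pow_succ] at hlt
  rw [Bouquet.numBoundary, Nat.card_eq_fintype_card]
  exact Nat.lt_succ_iff.1 ((Nat.pow_lt_pow_iff_right (by norm_num)).1 hlt)
end

section
/- Let B_n be the signed chord diagram on chords {1, …, n} with signed rotation [1, 2, …, n, 1, 2, …, n], i.e. chord k has endpoints {k−1, k−1+n} in Z/2nZ and every chord has sign +1. Let A ⊆ {1, …, n} with |A| = k ≥ 1. Then f((B_n)^{×|A}) = k. -/
open Finset Polynomial

namespace SimpleGraph

/-- A labelling of the vertices that is constant along edges and joins each vertex to a chosen
representative of its label counts the connected components. -/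
theorem card_connectedComponent_eq_of_section {V α : Type*} (G : SimpleGraph V) (f : V → α)
    (s : α → V) (hadj : ∀ u v, G.Adj u v → f u = f v) (hs : ∀ a, f (s a) = a)
    (hr : ∀ v, G.Reachable v (s (f v))) :
    Nat.card G.ConnectedComponent = Nat.card α := by
  have hwalk : ∀ u v (p : G.Walk u v), f u = f v := fun u v p => by
    induction p with
    | nil => rfl
    | cons h _ ih => exact (hadj _ _ h).trans ih
  refine Nat.card_congr
    { toFun := ConnectedComponent.lift f fun u v p _ => hwalk u v p
      invFun := fun a => G.connectedComponentMk (s a)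
      left_inv := fun c => ?_
      right_inv := fun a => hs a }
  induction c using ConnectedComponent.ind with
  | h v => exact ConnectedComponent.sound (hr v).symm

end SimpleGraph

/-- Each residue `j < n` can be labelled by the last element of `S` met at or before `j` in
cyclic order. -/
theorem exists_cyclic_predecessor {n : ℕ} (S : Finset ℕ) (hS : S.Nonempty)
    (hlt : ∀ a ∈ S, a < n) :
    ∃ L : ℕ → ℕ, (∀ j, L j ∈ S) ∧ (∀ j ∈ S, L j = j) ∧
      (∀ j, j + 1 ∉ S → j + 1 < n → L (j + 1) = L j) ∧ (0 ∉ S → L 0 = L (n - 1)) := by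
  obtain ⟨a, ha⟩ := hS
  have han := hlt a ha
  have hmem : ∀ b m, b ∈ S → b ≤ m → Nat.findGreatest (· ∈ S) m ∈ S := fun b m hb hbm =>
    Nat.findGreatest_spec (P := (· ∈ S)) hbm hb
  refine ⟨fun j => if ∃ b ≤ j, b ∈ S then Nat.findGreatest (· ∈ S) j
    else Nat.findGreatest (· ∈ S) (n - 1), fun j => ?_, fun j hj => ?_, fun j hj hjn => ?_,
    fun h0 => ?_⟩
  · dsimp only
    split_ifs with h
    · obtain ⟨b, hbj, hb⟩ := h
      exact hmem b j hb hbj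
    · exact hmem a _ ha (by omega)
  · dsimp only
    rw [if_pos ⟨j, le_rfl, hj⟩]
    exact le_antisymm (Nat.findGreatest_le j) (Nat.le_findGreatest le_rfl hj)
  · have hiff : (∃ b ≤ j + 1, b ∈ S) ↔ ∃ b ≤ j, b ∈ S := by
      refine ⟨fun ⟨b, hbj, hb⟩ => ⟨b, ?_, hb⟩, fun ⟨b, hbj, hb⟩ => ⟨b, by omega, hb⟩⟩
      have : b ≠ j + 1 := fun h => hj (h ▸ hb)
      omega
    simp only [hiff, Nat.findGreatest_of_not (P := (· ∈ S)) hj]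
  · have h : ¬ ∃ b ≤ 0, b ∈ S := fun ⟨b, hb0, hb⟩ => h0 (Nat.le_zero.1 hb0 ▸ hb)
    dsimp only
    rw [if_neg h, if_pos ⟨a, by omega, ha⟩]

theorem Nat.add_sub_one_mod_eq_ite {n : ℕ} (hn : 0 < n) (i : ℕ) :
    (i + n - 1) % n = if i % n = 0 then n - 1 else i % n - 1 := by
  have hlt : i % n < n := Nat.mod_lt _ hn
  have hdiv := Nat.mod_add_div i n
  split_ifs with h0
  · rw [show i + n - 1 = (n - 1) + n * (i / n) by omega, Nat.add_mul_mod_self_left,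
      Nat.mod_eq_of_lt (by omega)]
  · rw [show i + n - 1 = (i % n - 1) + n * (i / n) + n by omega,
      Nat.add_mod_right, Nat.add_mul_mod_self_left, Nat.mod_eq_of_lt (by omega)]

theorem Fin.add_sub_one_mod_of_val_eq_succ_mod {n : ℕ} {i j : Fin (2 * n)}
    (h : j.val = (i.val + 1) % (2 * n)) : (j.val + n - 1) % n = i.val % n := by
  have hi := i.2
  by_cases hlast : i.val + 1 < 2 * n
  · rw [Nat.mod_eq_of_lt hlast] at h
    rw [h, show i.val + 1 + n - 1 = i.val + n by omega, Nat.add_mod_right]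
  · rw [show i.val + 1 = 2 * n by omega, Nat.mod_self] at h
    rw [h, show i.val = n - 1 + n by omega, Nat.add_mod_right, Nat.zero_add]

theorem Fin.exists_val_eq_succ_mod {m : ℕ} (i : Fin m) :
    ∃ p : Fin m, i.val = (p.val + 1) % m := by
  have := i.2
  by_cases h : i.val = 0
  · exact ⟨⟨m - 1, by omega⟩, by rw [h, show m - 1 + 1 = m by omega, Nat.mod_self]⟩
  · exact ⟨⟨i.val - 1, by omega⟩, by
      rw [show i.val - 1 + 1 = i.val by omega, Nat.mod_eq_of_lt this]⟩

/-- The two ends of a chord `i, i + n` are distinct positions with the same residue. -/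
theorem Fin.exists_ne_mod_eq {n : ℕ} (i : Fin (2 * n)) :
    ∃ i' : Fin (2 * n), i'.val % n = i.val % n ∧ i ≠ i' := by
  have hi := i.2
  by_cases h : i.val < n
  · exact ⟨⟨i.val + n, by omega⟩, by simp, fun h' => by
      have := congrArg Fin.val h'
      simp only at this
      omega⟩
  · exact ⟨⟨i.val - n, by omega⟩, (Nat.mod_eq_sub_mod (by omega)).symm, fun h' => by
      have := congrArg Fin.val h'
      simp only at this
      omega⟩

/-- For the bouquet `B_n` with signed rotation `[1, 2, …, n, 1, 2, …, n]` (chord `k`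
occupies positions `k-1` and `k-1+n`, all signs `+1`), and any `A` of size `k ≥ 1`,
the partial Petrial `B_n^{×|A}` has exactly `k` boundary components. -/
theorem stmt10 {n : ℕ} (B : Bouquet n (Fin n))
    (hchord : ∀ i : Fin (2 * n), (B.chord i).val = i.val % n)
    (hsign : ∀ e : Fin n, B.sign e = true)
    (A : Finset (Fin n)) (k : ℕ) (hk : 1 ≤ k) (hA : A.card = k) :
    (B.petrial A).numBoundary = k := by
  set S : Finset ℕ := A.map Fin.valEmbedding with hSdef
  have hScard : S.card = k := by rw [hSdef, Finset.card_map, hA]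
  have hSne : S.Nonempty := Finset.card_pos.1 (by omega)
  have hSlt : ∀ a ∈ S, a < n := by
    intro a ha
    obtain ⟨b, -, rfl⟩ := Finset.mem_map.1 ha
    exact b.2
  have hn : 0 < n := by
    obtain ⟨a, ha⟩ := hSne
    have := hSlt a ha
    omega
  have hmem : ∀ i, B.chord i ∈ A ↔ i.val % n ∈ S := by
    intro i
    rw [← hchord i, hSdef]
    exact (Finset.mem_map' Fin.valEmbedding).symm
  have hsgn : ∀ i, (B.petrial A).sign ((B.petrial A).chord i) = true ↔ i.val % n ∉ S := by
    intro i
    change (if B.chord i ∈ A then !B.sign (B.chord i) else B.sign (B.chord i)) = true ↔ _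
    rw [← hmem i, hsign]
    split_ifs with h <;> simp [h]
  have hch : ∀ i j, (B.petrial A).chord i = (B.petrial A).chord j ↔ i.val % n = j.val % n := by
    intro i j
    rw [← hchord i, ← hchord j]
    exact Fin.ext_iff
  set G := (B.petrial A).boundaryGraph with hG
  have hadj : ∀ x y, G.Adj x y ↔ _ := fun x y => SimpleGraph.fromRel_adj _ x y
  obtain ⟨L, hLS, hLid, hLstep, hLwrap⟩ := exists_cyclic_predecessor S hSne hSlt
  -- the labels of the two gaps next to an untwisted chord agree
  have hLpred : ∀ i : Fin (2 * n), i.val % n ∉ S → L (i.val % n) = L ((i.val + n - 1) % n) := by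
    intro i hi
    have hlt : i.val % n < n := Nat.mod_lt _ hn
    rw [Nat.add_sub_one_mod_eq_ite hn]
    split_ifs with h0
    · rw [h0] at hi ⊢
      exact hLwrap hi
    · obtain ⟨m, hm⟩ := Nat.exists_eq_succ_of_ne_zero h0
      rw [hm] at hi ⊢
      exact hLstep m hi (by omega)
  let lab : Fin (2 * n) × Bool → S := fun x =>
    ⟨L (if x.2 then x.1.val % n else (x.1.val + n - 1) % n), hLS _⟩
  have hrel : ∀ x y : Fin (2 * n) × Bool,
      ((x.2 = true ∧ y.2 = false ∧ y.1.val = (x.1.val + 1) % (2 * n)) ∨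
      ((B.petrial A).chord x.1 = (B.petrial A).chord y.1 ∧ x.1 ≠ y.1 ∧
        (if (B.petrial A).sign ((B.petrial A).chord x.1) then x.2 ≠ y.2 else x.2 = y.2))) →
      lab x = lab y := by
    rintro ⟨i, b⟩ ⟨j, c⟩ h
    refine Subtype.ext ?_
    rcases h with ⟨hb, hc, h⟩ | ⟨h1, -, h2⟩
    · dsimp only at hb hc h
      subst hb hc
      exact congrArg L (Fin.add_sub_one_mod_of_val_eq_succ_mod h).symm
    · dsimp only at h1 h2
      rw [hch] at h1
      have h3 : (i.val + n - 1) % n = (j.val + n - 1) % n := by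
        rw [Nat.add_sub_one_mod_eq_ite hn, Nat.add_sub_one_mod_eq_ite hn, h1]
      split_ifs at h2 with hs
      · have h4 := hLpred i ((hsgn i).1 hs)
        cases b <;> cases c
        · exact absurd rfl h2
        · exact (h4.symm.trans (congrArg L h1) : L _ = L _)
        · exact (h4.trans (congrArg L h3) : L _ = L _)
        · exact absurd rfl h2
      · subst h2
        simp only [lab, h1, h3]
  have hσ : ∀ i j : Fin (2 * n), j.val = (i.val + 1) % (2 * n) → G.Adj (i, true) (j, false) :=
    fun i j h => (hadj _ _).2 ⟨by simp, Or.inl (Or.inl ⟨rfl, rfl, h⟩)⟩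
  have hτ : ∀ (i j : Fin (2 * n)) (b c : Bool), i.val % n = j.val % n → i ≠ j →
      (if i.val % n ∈ S then b = c else b ≠ c) → G.Adj (i, b) (j, c) := by
    intro i j b c h hij hbc
    refine (hadj _ _).2 ⟨fun he => hij (congrArg Prod.fst he), Or.inl (Or.inr
      ⟨(hch i j).2 h, hij, ?_⟩)⟩
    by_cases hs : i.val % n ∈ S
    · rw [if_pos hs] at hbc
      rw [if_neg fun h => (hsgn i).1 h hs]
      exact hbc
    · rw [if_neg hs] at hbc
      rw [if_pos ((hsgn i).2 hs)]
      exact hbc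
  -- both positive points of the chord `j` reach the representative of their label
  let rep : S → Fin (2 * n) × Bool := fun a => (⟨a.1, by have := hSlt a.1 a.2; omega⟩, true)
  let Good : ℕ → Prop := fun j => ∀ i : Fin (2 * n), i.val % n = j →
    G.Reachable (i, true) (rep ⟨L j, hLS j⟩)
  have hgood_mem : ∀ j ∈ S, Good j := by
    intro j hj i hi
    have hjn := hSlt j hj
    have hr : rep ⟨L j, hLS j⟩ = (⟨j, by omega⟩, true) := by simp [rep, hLid j hj]
    rw [hr]
    by_cases hij : i = ⟨j, by omega⟩
    · exact hij ▸ SimpleGraph.Reachable.rfl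
    · exact (hτ _ _ _ _ (by rw [hi, Nat.mod_eq_of_lt hjn]) hij (by simp [hi, hj])).reachable
  -- cross an untwisted chord and then the gap before its other endpoint
  have hstep : ∀ j j', j < n → j ∉ S → L j = L j' → (j' + 1) % n = j → j' < n →
      Good j' → Good j := by
    intro j j' hjn hj hL hjj hjn' hg i hi
    obtain ⟨i', hi', hne⟩ := i.exists_ne_mod_eq
    obtain ⟨p, hp⟩ := i'.exists_val_eq_succ_mod
    have hpm : p.val % n = j' := by
      have h : (p.val + 1) % n = (j' + 1) % n := by
        rw [hjj, ← hi, ← hi', hp, Nat.mod_mul_left_mod]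
      have h' : p.val % n = j' % n := Nat.ModEq.add_right_cancel' 1 h
      rw [h', Nat.mod_eq_of_lt hjn']
    have hr : rep ⟨L j, hLS j⟩ = rep ⟨L j', hLS j'⟩ := by simp only [hL]
    rw [hr]
    exact ((hτ i i' true false hi'.symm hne (by simp [hi, hj])).reachable.trans
      (hσ p i' hp).symm.reachable).trans (hg p hpm)
  have hsucc : ∀ j, j + 1 < n → Good j → Good (j + 1) := by
    intro j hj hg
    by_cases h : j + 1 ∈ S
    · exact hgood_mem _ h
    · exact hstep _ j hj h (hLstep j h hj) (Nat.mod_eq_of_lt hj) (by omega) hg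
  have hup : ∀ a, Good a → ∀ j, a ≤ j → j < n → Good j := by
    intro a ha j haj
    induction j, haj using Nat.le_induction with
    | base => exact fun _ => ha
    | succ m _ ih => exact fun hm => hsucc m hm (ih (by omega))
  have hzero : Good 0 := by
    by_cases h : 0 ∈ S
    · exact hgood_mem 0 h
    · obtain ⟨a, ha⟩ := hSne
      have han := hSlt a ha
      exact hstep 0 (n - 1) hn h (hLwrap h) (by rw [Nat.sub_add_cancel hn, Nat.mod_self])
        (by omega) (hup a (hgood_mem a ha) (n - 1) (by omega) (by omega))
  have hplus : ∀ i : Fin (2 * n), G.Reachable (i, true) (rep (lab (i, true))) := fun i =>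
    hup 0 hzero _ (Nat.zero_le _) (Nat.mod_lt _ hn) i rfl
  have hlab : ∀ x y, G.Adj x y → lab x = lab y := by
    intro x y h
    rcases ((hadj x y).1 h).2 with h | h
    · exact hrel x y h
    · exact (hrel y x h).symm
  have hcount : Nat.card G.ConnectedComponent = Nat.card S := by
    refine G.card_connectedComponent_eq_of_section lab rep hlab (fun a => ?_) ?_
    · refine Subtype.ext ?_
      simp only [lab, rep, if_true, Nat.mod_eq_of_lt (hSlt a.1 a.2)]
      exact hLid a.1 a.2
    · rintro ⟨i, b⟩
      cases b
      · obtain ⟨p, hp⟩ := i.exists_val_eq_succ_mod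
        have h := hσ p i hp
        rw [← hlab _ _ h]
        exact h.symm.reachable.trans (hplus p)
      · exact hplus i
  rw [Bouquet.numBoundary, ← hG, hcount, Nat.card_eq_fintype_card, Fintype.card_coe, hScard]
end

section
/- Let B_n be the signed chord diagram on chords {1, …, n} (n ≥ 1) with signed rotation [1, 2, …, n, 1, 2, …, n], i.e. chord k has endpoints {k−1, k−1+n} in Z/2nZ and every chord has sign +1. Then f(B_n) = 1 if n is even, and f(B_n) = 2 if n is odd. -/
open Finset Polynomial

namespace Bouquet

variable {n : ℕ} {B : Bouquet n (Fin n)}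

/-- The matching `σ` joins `i⁻` to `(i-1)⁺`. -/
lemma reachable_minus {i j : Fin (2 * n)} (h : i.val = (j.val + 1) % (2 * n)) :
    B.boundaryGraph.Reachable (i, false) (j, true) := by
  apply SimpleGraph.Adj.reachable
  rw [boundaryGraph, SimpleGraph.fromRel_adj]
  exact ⟨by simp, Or.inr (Or.inl ⟨rfl, rfl, h⟩)⟩

/-- The matching `τ` joins `i⁺` to `j⁻` when `i` and `j` are the endpoints of an
untwisted chord. -/
lemma reachable_opposite (hchord : ∀ i : Fin (2 * n), (B.chord i).val = i.val % n)
    (hsign : ∀ e : Fin n, B.sign e = true) {i j : Fin (2 * n)}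
    (h : i.val = j.val + n ∨ j.val = i.val + n) :
    B.boundaryGraph.Reachable (i, true) (j, false) := by
  have hpos : 0 < n := by have := i.isLt; omega
  apply SimpleGraph.Adj.reachable
  rw [boundaryGraph, SimpleGraph.fromRel_adj]
  refine ⟨by simp, Or.inl (Or.inr ⟨?_, ?_, ?_⟩)⟩
  · apply Fin.ext
    rw [hchord, hchord]
    rcases h with h | h <;> simp [h]
  · intro hij
    have := congrArg Fin.val hij
    dsimp only at this
    omega
  · simp [hsign]

/-- Following `τ` and then `σ` moves from `i⁺` to `j⁺` with `j = i + n - 1` modulo `2n`. -/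
lemma reachable_step (hchord : ∀ i : Fin (2 * n), (B.chord i).val = i.val % n)
    (hsign : ∀ e : Fin n, B.sign e = true) {i j : Fin (2 * n)}
    (h : i.val = j.val + 1 + n ∨ j.val + 1 = i.val + n ∨
      (i.val = n ∧ j.val + 1 = 2 * n)) :
    B.boundaryGraph.Reachable (i, true) (j, true) := by
  have hi := i.isLt
  have hj := j.isLt
  rcases Nat.lt_or_ge i.val n with hlt | hge
  · refine (reachable_opposite hchord hsign (j := ⟨i.val + n, by omega⟩) (Or.inr rfl)).trans
      (reachable_minus ?_)
    rw [Nat.mod_eq_of_lt (by omega)]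
    change i.val + n = _
    omega
  · refine (reachable_opposite hchord hsign (j := ⟨i.val - n, by omega⟩)
      (Or.inl (by change _ = i.val - n + n; omega))).trans (reachable_minus ?_)
    change i.val - n = _
    by_cases hw : j.val + 1 = 2 * n
    · rw [hw, Nat.mod_self]
      omega
    · rw [Nat.mod_eq_of_lt (by omega)]
      omega

lemma reachable_sub_two (hchord : ∀ i : Fin (2 * n), (B.chord i).val = i.val % n)
    (hsign : ∀ e : Fin n, B.sign e = true) {i j : Fin (2 * n)}
    (h : i.val = j.val + 2) :
    B.boundaryGraph.Reachable (i, true) (j, true) := by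
  have hi := i.isLt
  rcases lt_trichotomy i.val n with hlt | heq | hgt
  · exact (reachable_step hchord hsign (j := ⟨i.val + n - 1, by omega⟩)
      (by dsimp only; omega)).trans (reachable_step hchord hsign (by dsimp only; omega))
  · exact (reachable_step hchord hsign (j := ⟨2 * n - 1, by omega⟩)
      (by dsimp only; omega)).trans (reachable_step hchord hsign (by dsimp only; omega))
  · exact (reachable_step hchord hsign (j := ⟨i.val - n - 1, by omega⟩)
      (by dsimp only; omega)).trans (reachable_step hchord hsign (by dsimp only; omega))

lemma reachable_mod_two (hchord : ∀ i : Fin (2 * n), (B.chord i).val = i.val % n)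
    (hsign : ∀ e : Fin n, B.sign e = true) (k : ℕ) (hk : k < 2 * n) :
    B.boundaryGraph.Reachable (⟨k, hk⟩, true)
      (⟨k % 2, (Nat.mod_le k 2).trans_lt hk⟩, true) := by
  induction k using Nat.strong_induction_on with
  | _ k ih =>
    by_cases h : k < 2
    · simp only [Nat.mod_eq_of_lt h]
      rfl
    · have hr := ih (k - 2) (by omega) (by omega)
      have hm : (k - 2) % 2 = k % 2 := by omega
      simp only [hm] at hr
      exact (reachable_sub_two hchord hsign (by dsimp only; omega)).trans hr

lemma reachable_zero_or_one (hn : 1 ≤ n)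
    (hchord : ∀ i : Fin (2 * n), (B.chord i).val = i.val % n)
    (hsign : ∀ e : Fin n, B.sign e = true) (x : Fin (2 * n) × Bool) :
    B.boundaryGraph.Reachable x (⟨0, by omega⟩, true) ∨
      B.boundaryGraph.Reachable x (⟨1, by omega⟩, true) := by
  have plus (j : Fin (2 * n)) : B.boundaryGraph.Reachable (j, true) (⟨0, by omega⟩, true) ∨
      B.boundaryGraph.Reachable (j, true) (⟨1, by omega⟩, true) := by
    have hr := reachable_mod_two hchord hsign j.val j.isLt
    rcases Nat.mod_two_eq_zero_or_one j.val with h | h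
    · simp only [h] at hr
      exact Or.inl hr
    · simp only [h] at hr
      exact Or.inr hr
  obtain ⟨i, b⟩ := x
  cases b with
  | true => exact plus i
  | false =>
    obtain ⟨j, hj⟩ : ∃ j : Fin (2 * n), i.val = (j.val + 1) % (2 * n) := by
      have hi := i.isLt
      by_cases h : i.val = 0
      · refine ⟨⟨2 * n - 1, by omega⟩, ?_⟩
        dsimp only
        rw [Nat.sub_add_cancel (by omega), Nat.mod_self, h]
      · refine ⟨⟨i.val - 1, by omega⟩, ?_⟩
        dsimp only
        rw [Nat.sub_add_cancel (by omega), Nat.mod_eq_of_lt hi]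
    exact (plus j).imp (reachable_minus hj).trans (reachable_minus hj).trans

/-- For `n` odd, the parity of `i` on `i⁺` and of `i + 1` on `i⁻` is constant along
boundary components. -/
lemma parity_eq_of_reachable (hodd : n % 2 = 1)
    (hchord : ∀ i : Fin (2 * n), (B.chord i).val = i.val % n)
    (hsign : ∀ e : Fin n, B.sign e = true) {x y : Fin (2 * n) × Bool}
    (h : B.boundaryGraph.Reachable x y) :
    (x.1.val + x.2.toNat) % 2 = (y.1.val + y.2.toNat) % 2 := by
  have rel (x y : Fin (2 * n) × Bool)
      (h : (x.2 = true ∧ y.2 = false ∧ y.1.val = (x.1.val + 1) % (2 * n)) ∨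
        (B.chord x.1 = B.chord y.1 ∧ x.1 ≠ y.1 ∧
          (if B.sign (B.chord x.1) then x.2 ≠ y.2 else x.2 = y.2))) :
      (x.1.val + x.2.toNat) % 2 = (y.1.val + y.2.toNat) % 2 := by
    obtain ⟨i, b⟩ := x
    obtain ⟨j, c⟩ := y
    have hi := i.isLt
    have hj := j.isLt
    rcases h with ⟨hb, hc, h⟩ | ⟨h, hne, hs⟩
    · dsimp only at hb hc h
      subst hb hc
      have hm : j.val % 2 = (i.val + 1) % 2 := by
        rw [h, Nat.mod_mod_of_dvd _ (dvd_mul_right 2 n)]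
      simp [hm]
    · dsimp only at h hne hs
      rw [hsign, if_pos rfl] at hs
      have hv : i.val ≠ j.val := fun e => hne (Fin.ext e)
      have hmod : i.val % n = j.val % n := by rw [← hchord, ← hchord, h]
      have mod_cases (k : ℕ) (hk : k < 2 * n) : k % n = k ∨ k % n + n = k := by
        rcases Nat.lt_or_ge k n with hlt | hge
        · exact Or.inl (Nat.mod_eq_of_lt hlt)
        · right
          rw [Nat.mod_eq_sub_mod hge, Nat.mod_eq_of_lt (by omega)]
          omega
      have hi' := mod_cases i.val hi
      have hj' := mod_cases j.val hj
      cases b <;> cases c <;> simp at hs ⊢ <;> omega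
  obtain ⟨p⟩ := h
  induction p with
  | nil => rfl
  | cons hadj _ ih =>
    rw [boundaryGraph, SimpleGraph.fromRel_adj] at hadj
    exact (hadj.2.elim (rel _ _) fun h => (rel _ _ h).symm).trans ih

end Bouquet

/-- The bouquet `B_n` with signed rotation `[1, 2, …, n, 1, 2, …, n]` (chord `k`
occupies positions `k-1` and `k-1+n`, all signs `+1`) has one boundary component when
`n` is even and two when `n` is odd. -/
theorem stmt11 {n : ℕ} (hn : 1 ≤ n) (B : Bouquet n (Fin n))
    (hchord : ∀ i : Fin (2 * n), (B.chord i).val = i.val % n)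
    (hsign : ∀ e : Fin n, B.sign e = true) :
    B.numBoundary = if n % 2 = 0 then 1 else 2 := by
  have cover := Bouquet.reachable_zero_or_one hn hchord hsign
  rw [Bouquet.numBoundary]
  split_ifs with heven
  · have h01 : B.boundaryGraph.Reachable (⟨0, by omega⟩, true) (⟨1, by omega⟩, true) := by
      have hr := Bouquet.reachable_mod_two hchord hsign (n - 1) (by omega)
      have hm : (n - 1) % 2 = 1 := by omega
      simp only [hm] at hr
      exact (Bouquet.reachable_step hchord hsign (by dsimp only; omega)).trans hr
    rw [Nat.card_eq_one_iff_exists]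
    refine ⟨B.boundaryGraph.connectedComponentMk (⟨1, by omega⟩, true), fun c => ?_⟩
    induction c using SimpleGraph.ConnectedComponent.ind with
    | _ x => exact SimpleGraph.ConnectedComponent.sound ((cover x).elim (·.trans h01) id)
  · rw [Nat.card_eq_two_iff]
    refine ⟨B.boundaryGraph.connectedComponentMk (⟨0, by omega⟩, true),
      B.boundaryGraph.connectedComponentMk (⟨1, by omega⟩, true), fun h => ?_, ?_⟩
    · have := Bouquet.parity_eq_of_reachable (by omega) hchord hsign
        (SimpleGraph.ConnectedComponent.exact h)
      simp at this
    · refine Set.eq_univ_of_forall fun c => ?_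
      induction c using SimpleGraph.ConnectedComponent.ind with
      | _ x =>
        rw [Set.mem_insert_iff, Set.mem_singleton_iff]
        exact (cover x).imp SimpleGraph.ConnectedComponent.sound
          SimpleGraph.ConnectedComponent.sound
end
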